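/- arXiv:1505.06157 — 2 statements merged into one kernel-verified Lean document; each statement's English description precedes it below -/
import Mathlib

section
/- Let α > 0, let n be an integer with |n| ≥ 1, let R > 0 and let κ satisfy −(r₀² + n²)/(2R²) < κ < α⁻¹. Then there exist constants C₃ > 0 and C₂ > 0 such that every u in the Nehari set M satisfies ∫₀^R r u(r)²/(1 + α u(r)²) dr ≥ C₃ and ∫₀^R r u(r)⁴/(1 + α u(r)²)² dr ≥ C₂. -/
open MeasureTheory Set Filter

noncomputable section

/-- The Bessel function `J₀`. -/
def besselJ0 (x : ℝ) : ℝ :=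
  ∑' m : ℕ, (-1 : ℝ) ^ m * (x / 2) ^ (2 * m) / ((Nat.factorial m : ℝ)) ^ 2

/-- The smallest positive zero of `J₀` (≈ 2.404826). -/
def besselR0 : ℝ := sInf {x : ℝ | 0 < x ∧ besselJ0 x = 0}

/-- `u` is a classical solution of the `n`-vortex equation with parameters `(α, n, κ, R)`. -/
def IsVortexSol (α : ℝ) (n : ℤ) (κ R : ℝ) (u : ℝ → ℝ) : Prop :=
  ContinuousOn u (Icc 0 R) ∧
  (∀ r ∈ Ioo (0 : ℝ) R, DifferentiableAt ℝ u r ∧ DifferentiableAt ℝ (deriv u) r) ∧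
  u 0 = 0 ∧ u R = 0 ∧
  ∀ r ∈ Ioo (0 : ℝ) R,
    deriv (fun s => s * deriv u s) r - ((n : ℝ) ^ 2 / r) * u r
      + 2 * r * (u r) ^ 3 / (1 + α * (u r) ^ 2) - 2 * κ * r * u r = 0

/-- `u` has finite energy. -/
def FiniteEnergy (α R : ℝ) (u : ℝ → ℝ) : Prop :=
  IntegrableOn
    (fun r => r * (deriv u r) ^ 2 + (u r) ^ 2 / r + r * Real.log (1 + α * (u r) ^ 2))
    (Ioo 0 R)

/-- The energy flux `Q(u) = 2π ∫₀^R r u(r)² dr`. -/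
def fluxQ (R : ℝ) (u : ℝ → ℝ) : ℝ := 2 * Real.pi * ∫ r in Ioo (0 : ℝ) R, r * (u r) ^ 2

/-- The tent function with parameters `a` and `b`. -/
def tent (a b : ℝ) : ℝ → ℝ := fun r => if r ≤ a then (b / a) * r else (b / a) * (2 * a - r)

/-- The action functional `I_κ`. -/
def actI (α : ℝ) (n : ℤ) (κ R : ℝ) (u : ℝ → ℝ) : ℝ :=
  (1 / 2) * ∫ r in Ioo (0 : ℝ) R,
    (r * (deriv u r) ^ 2 + ((n : ℝ) ^ 2 / r) * (u r) ^ 2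
      - 2 * (α⁻¹ - κ) * r * (u r) ^ 2 + 2 * (α ^ 2)⁻¹ * r * Real.log (1 + α * (u r) ^ 2))

/-- The action functional `𝓘`. -/
def actI0 (α : ℝ) (n : ℤ) (R : ℝ) (u : ℝ → ℝ) : ℝ :=
  (1 / 2) * ∫ r in Ioo (0 : ℝ) R,
    (r * (deriv u r) ^ 2 + ((n : ℝ) ^ 2 / r) * (u r) ^ 2
      - 2 * α⁻¹ * r * (u r) ^ 2 + 2 * (α ^ 2)⁻¹ * r * Real.log (1 + α * (u r) ^ 2))

/-- The functional `γ_κ`. -/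
def gammaK (α : ℝ) (n : ℤ) (κ R : ℝ) (u : ℝ → ℝ) : ℝ :=
  (1 / 2) * ∫ r in Ioo (0 : ℝ) R,
    (r * (deriv u r) ^ 2 + ((n : ℝ) ^ 2 / r) * (u r) ^ 2
      - 2 * (α⁻¹ - κ) * r * (u r) ^ 2 + 2 * α⁻¹ * r * (u r) ^ 2 / (1 + α * (u r) ^ 2))

/-- Membership in the class `X`. -/
def MemX (R : ℝ) (u : ℝ → ℝ) : Prop :=
  ContinuousOn u (Icc 0 R) ∧ ContDiffOn ℝ 1 u (Ioo 0 R) ∧ u 0 = 0 ∧ u R = 0 ∧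
    IntegrableOn (fun r => r * (deriv u r) ^ 2 + (u r) ^ 2 / r) (Ioo 0 R)

/-- Membership in the class `X`, allowing finitely many exceptional points. -/
def MemX' (R : ℝ) (u : ℝ → ℝ) : Prop :=
  ContinuousOn u (Icc 0 R) ∧ (∃ S : Finset ℝ, ContDiffOn ℝ 1 u (Ioo 0 R \ ↑S)) ∧
    u 0 = 0 ∧ u R = 0 ∧
    IntegrableOn (fun r => r * (deriv u r) ^ 2 + (u r) ^ 2 / r) (Ioo 0 R)

/-- The admissible class `𝒜`. -/
def Admissible (α R : ℝ) (v : ℝ → ℝ) : Prop :=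
  (∃ K : NNReal, LipschitzOnWith K v (Icc 0 R)) ∧ v 0 = 0 ∧ v R = 0 ∧ FiniteEnergy α R v

end

/-! ### Power series -/

lemma ps_summable (a : ℕ → ℝ) (ha : ∀ m, |a m| ≤ 1 / (m.factorial : ℝ)) (t : ℝ) :
    Summable (fun m => a m * t ^ m) := by
  refine Summable.of_norm_bounded (Real.summable_pow_div_factorial |t|) (fun m => ?_)
  rw [Real.norm_eq_abs, abs_mul, abs_pow]
  calc |a m| * |t| ^ m ≤ 1 / (m.factorial : ℝ) * |t| ^ m := by gcongr; exact ha m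
    _ = _ := by ring

lemma ps_hasDerivAt (a : ℕ → ℝ) (ha : ∀ m, |a m| ≤ 1 / (m.factorial : ℝ)) (t : ℝ) :
    HasDerivAt (fun t => ∑' m, a m * t ^ m) (∑' m : ℕ, ((m : ℝ) + 1) * a (m + 1) * t ^ m) t := by
  set K : ℝ := |t| + 1 with hK
  have hK0 : 0 < K := by positivity
  have hsum : Summable (fun m : ℕ => (m : ℝ) * (1 / (m.factorial : ℝ)) * K ^ (m - 1)) := by
    rw [← summable_nat_add_iff 1]
    refine (Real.summable_pow_div_factorial K).congr (fun m => ?_)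
    rw [Nat.factorial_succ]
    have : (m.factorial : ℝ) ≠ 0 := by positivity
    push_cast
    have h2 : (m : ℝ) + 1 ≠ 0 := by positivity
    field_simp
  have hb : ∀ (m : ℕ) (y : ℝ), y ∈ Metric.ball (0:ℝ) K →
      ‖a m * ((m : ℝ) * y ^ (m - 1))‖ ≤ (m : ℝ) * (1 / (m.factorial : ℝ)) * K ^ (m - 1) := by
    intro m y hy
    have hy' : |y| ≤ K := by
      have := hy; rw [mem_ball_zero_iff, Real.norm_eq_abs] at this; exact this.le
    rw [Real.norm_eq_abs, abs_mul, abs_mul, abs_pow, Nat.abs_cast]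
    calc |a m| * ((m : ℝ) * |y| ^ (m - 1))
        ≤ (1 / (m.factorial : ℝ)) * ((m : ℝ) * K ^ (m - 1)) := by
          gcongr
          exact ha m
      _ = _ := by ring
  have ht : t ∈ Metric.ball (0:ℝ) K := by
    rw [mem_ball_zero_iff, Real.norm_eq_abs]; linarith
  have h := hasDerivAt_tsum_of_isPreconnected hsum Metric.isOpen_ball
    (convex_ball (0:ℝ) K).isPreconnected
    (fun m y _ => (hasDerivAt_pow m y).const_mul (a m)) hb ht (ps_summable a ha t) ht
  refine h.congr_deriv ?_
  rw [Summable.tsum_eq_zero_add (f := fun m : ℕ => a m * ((m : ℝ) * t ^ (m - 1)))]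
  · simp only [Nat.cast_zero, zero_mul, mul_zero, zero_add, Nat.add_sub_cancel]
    refine tsum_congr (fun m => ?_)
    push_cast; ring
  · exact Summable.of_norm_bounded hsum (fun m => hb m t ht)

noncomputable def bA (m : ℕ) : ℝ := (-1) ^ m / (m.factorial : ℝ) ^ 2

noncomputable def bH (t : ℝ) : ℝ := ∑' m : ℕ, bA m * t ^ m

noncomputable def bH1 (t : ℝ) : ℝ := ∑' m : ℕ, (((m : ℝ) + 1) * bA (m + 1)) * t ^ m

noncomputable def bK (t : ℝ) : ℝ := ∑' m : ℕ, ((m : ℝ) * bA m) * t ^ m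

lemma fact_ge_one (m : ℕ) : (1 : ℝ) ≤ (m.factorial : ℝ) := by
  exact_mod_cast Nat.factorial_pos m

lemma bA_abs (m : ℕ) : |bA m| = 1 / (m.factorial : ℝ) ^ 2 := by
  unfold bA
  rw [abs_div, abs_pow, abs_neg, abs_one, one_pow, abs_of_nonneg (by positivity)]

lemma bA_le (m : ℕ) : |bA m| ≤ 1 / (m.factorial : ℝ) := by
  rw [bA_abs]
  have := fact_ge_one m
  apply one_div_le_one_div_of_le (by positivity)
  nlinarith

lemma bmA_le (m : ℕ) : |(m : ℝ) * bA m| ≤ 1 / (m.factorial : ℝ) := by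
  rw [abs_mul, bA_abs, Nat.abs_cast]
  have h1 := fact_ge_one m
  have h2 : (m : ℝ) ≤ m.factorial := by exact_mod_cast Nat.self_le_factorial m
  rw [mul_one_div, div_le_div_iff₀ (by positivity) (by positivity)]
  nlinarith

lemma bH_hasDerivAt (t : ℝ) : HasDerivAt bH (bH1 t) t := ps_hasDerivAt bA bA_le t

lemma bA_rec (m : ℕ) : ((m : ℝ) + 1) * (((m + 1 : ℕ) : ℝ) * bA (m + 1)) = - bA m := by
  unfold bA
  rw [Nat.factorial_succ]
  have h1 : (m.factorial : ℝ) ≠ 0 := by positivity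
  have h2 : (m : ℝ) + 1 ≠ 0 := by positivity
  push_cast
  field_simp
  ring

lemma bK_hasDerivAt (t : ℝ) : HasDerivAt bK (- bH t) t := by
  have h := ps_hasDerivAt (fun m => (m : ℝ) * bA m) bmA_le t
  have e : (∑' m : ℕ, ((m : ℝ) + 1) * (((m + 1 : ℕ) : ℝ) * bA (m + 1)) * t ^ m) = - bH t := by
    unfold bH
    rw [← tsum_neg]
    refine tsum_congr (fun m => ?_)
    rw [bA_rec]; ring
  rw [← e]
  exact h

lemma bK_eq (t : ℝ) : bK t = t * bH1 t := by
  unfold bK bH1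
  rw [Summable.tsum_eq_zero_add (ps_summable (fun m => (m : ℝ) * bA m) bmA_le t), ← tsum_mul_left]
  simp only [Nat.cast_zero, zero_mul, zero_add]
  refine tsum_congr (fun m => ?_)
  push_cast; ring

lemma bessel_eq (x : ℝ) : besselJ0 x = bH (x ^ 2 / 4) := by
  unfold besselJ0 bH bA
  refine tsum_congr (fun m => ?_)
  rw [pow_mul, div_pow]
  norm_num
  ring

lemma bessel_zero : besselJ0 0 = 1 := by
  rw [bessel_eq]
  unfold bH
  rw [tsum_eq_single 0]
  · simp [bA]
  · intro m hm; simp [hm]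

lemma bessel_cont : Continuous besselJ0 := by
  have : besselJ0 = fun x => bH (x ^ 2 / 4) := funext bessel_eq
  rw [this]
  have h : Continuous bH := continuous_iff_continuousAt.2 fun t => (bH_hasDerivAt t).continuousAt
  fun_prop

lemma bessel_pos {x y : ℝ} (hx : x < besselR0 ∨ x = 0) (hy0 : 0 ≤ y) (hyx : y ≤ x) :
    0 < besselJ0 y := by
  by_contra hneg
  push Not at hneg
  have hy : 0 < y := by
    rcases hy0.eq_or_lt with h | h
    · rw [← h, bessel_zero] at hneg; linarith
    · exact h
  have hx' : x < besselR0 := by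
    rcases hx with h | h
    · exact h
    · linarith
  obtain ⟨z, hz, hz0⟩ := intermediate_value_Icc' hy0 bessel_cont.continuousOn
    (show (0:ℝ) ∈ Icc (besselJ0 y) (besselJ0 0) from ⟨hneg, by rw [bessel_zero]; norm_num⟩)
  have hzpos : 0 < z := by
    rcases hz.1.eq_or_lt with h | h
    · rw [← h, bessel_zero] at hz0; norm_num at hz0
    · exact h
  have : besselR0 ≤ z := csInf_le ⟨0, fun w hw => hw.1.le⟩ ⟨hzpos, hz0⟩
  linarith [hz.2]

/-! ### Integrability -/

section
variable {R : ℝ} {u : ℝ → ℝ}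

lemma X_diff (hu : MemX R u) {r : ℝ} (hr : r ∈ Ioo 0 R) : HasDerivAt u (deriv u r) r :=
  ((hu.2.1.differentiableOn one_ne_zero).differentiableAt (isOpen_Ioo.mem_nhds hr)).hasDerivAt

lemma X_meas (hu : MemX R u) : AEMeasurable u (volume.restrict (Ioo 0 R)) :=
  (hu.1.mono Ioo_subset_Icc_self).aemeasurable measurableSet_Ioo

lemma X_intA (hu : MemX R u) : IntegrableOn (fun r => r * (deriv u r) ^ 2) (Ioo 0 R) := by
  refine Integrable.mono' hu.2.2.2.2 ?_ ?_
  · have := measurable_deriv u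
    exact (by fun_prop : Measurable (fun r => r * (deriv u r) ^ 2)).aestronglyMeasurable
  · refine (ae_restrict_iff' measurableSet_Ioo).2 (Eventually.of_forall fun r hr => ?_)
    have h0 : 0 < r := hr.1
    rw [Real.norm_eq_abs, abs_of_nonneg (by positivity)]
    have : 0 ≤ u r ^ 2 / r := by positivity
    linarith

lemma X_intB (hu : MemX R u) : IntegrableOn (fun r => (u r) ^ 2 / r) (Ioo 0 R) := by
  have := hu.2.2.2.2.sub (X_intA hu)
  refine this.congr (Eventually.of_forall fun r => ?_)
  simp

lemma X_intC (hu : MemX R u) (g : ℝ → ℝ) (hg : Continuous g) :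
    IntegrableOn (fun r => r * g (u r)) (Ioo 0 R) := by
  refine IntegrableOn.mono_set ?_ Ioo_subset_Icc_self
  refine ContinuousOn.integrableOn_Icc ?_
  exact continuousOn_id.mul (hg.comp_continuousOn hu.1)

lemma X_poinc (hR : 0 < R) (hu : MemX R u) {l : ℝ} (hl : 0 ≤ l)
    (hx : l * R < besselR0 ∨ l * R = 0) :
    l ^ 2 * ∫ r in Ioo 0 R, r * (u r) ^ 2 ≤ ∫ r in Ioo 0 R, r * (deriv u r) ^ 2 := by
  have hpos : ∀ r ∈ Icc 0 R, 0 < bH ((l * r) ^ 2 / 4) := by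
    intro r hr
    rw [← bessel_eq]
    exact bessel_pos hx (mul_nonneg hl hr.1) (mul_le_mul_of_nonneg_left hr.2 hl)
  have hP := X_intC hu (fun x => x ^ 2) (by fun_prop)
  have hA := X_intA hu
  set G : ℝ → ℝ := fun r => 2 * bK ((l * r) ^ 2 / 4) / bH ((l * r) ^ 2 / 4) * (u r) ^ 2 with hG
  have hcH : Continuous bH := continuous_iff_continuousAt.2 fun t => (bH_hasDerivAt t).continuousAt
  have hcK : Continuous bK := continuous_iff_continuousAt.2 fun t => (bK_hasDerivAt t).continuousAt
  have hGc : ContinuousOn G (Icc 0 R) := by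
    refine ContinuousOn.mul (ContinuousOn.div (by fun_prop) (by fun_prop) ?_) (hu.1.pow 2)
    intro r hr; exact (hpos r hr).ne'
  have hI : IntegrableOn (fun r => r * (deriv u r) ^ 2 - l ^ 2 * (r * (u r) ^ 2)) (Ioo 0 R) :=
    hA.sub (hP.const_mul _)
  have key := intervalIntegral.sub_le_integral_of_hasDeriv_right_of_le (g := G)
    (g' := fun r => ((2 * (- bH ((l * r) ^ 2 / 4) * (l ^ 2 * r / 2))) * bH ((l * r) ^ 2 / 4)
      - 2 * bK ((l * r) ^ 2 / 4) * (bH1 ((l * r) ^ 2 / 4) * (l ^ 2 * r / 2)))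
        / bH ((l * r) ^ 2 / 4) ^ 2 * (u r) ^ 2
      + 2 * bK ((l * r) ^ 2 / 4) / bH ((l * r) ^ 2 / 4) * (2 * u r * deriv u r))
    (φ := fun r => r * (deriv u r) ^ 2 - l ^ 2 * (r * (u r) ^ 2)) hR.le hGc ?_
    ((integrableOn_Icc_iff_integrableOn_Ioo).2 hI) ?_
  · rw [intervalIntegral.integral_of_le hR.le, integral_Ioc_eq_integral_Ioo,
      integral_sub hA (hP.const_mul _), integral_const_mul] at key
    simp only [hG, hu.2.2.1, hu.2.2.2.1] at key
    norm_num at key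
    linarith
  · intro r hr
    have hp := hpos r (Ioo_subset_Icc_self hr)
    have hs : HasDerivAt (fun r : ℝ => (l * r) ^ 2 / 4) (l ^ 2 * r / 2) r := by
      have := (((hasDerivAt_id r).const_mul l).pow 2).div_const 4
      refine this.congr_deriv ?_
      simp; ring
    have h1 := ((bK_hasDerivAt ((l * r) ^ 2 / 4)).comp r hs).const_mul 2
    have h2 := (bH_hasDerivAt ((l * r) ^ 2 / 4)).comp r hs
    have h3 := (X_diff hu hr).pow 2
    have := (h1.div h2 hp.ne').mul h3
    refine HasDerivAt.hasDerivWithinAt ?_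
    refine this.congr_deriv ?_
    simp
  · intro r hr
    have hp := hpos r (Ioo_subset_Icc_self hr)
    have hr0 : 0 < r := hr.1
    simp only [bK_eq]
    set h := bH ((l * r) ^ 2 / 4)
    set d := bH1 ((l * r) ^ 2 / 4)
    have : r * (deriv u r) ^ 2 - l ^ 2 * (r * (u r) ^ 2)
      - (((2 * (- h * (l ^ 2 * r / 2))) * h
      - 2 * ((l * r) ^ 2 / 4 * d) * (d * (l ^ 2 * r / 2)))
        / h ^ 2 * (u r) ^ 2
      + 2 * ((l * r) ^ 2 / 4 * d) / h * (2 * u r * deriv u r))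
      = r * (deriv u r - u r * (d * (l ^ 2 * r / 2)) / h) ^ 2 := by
      field_simp
      ring
    have h4 : 0 ≤ r * (deriv u r - u r * (d * (l ^ 2 * r / 2)) / h) ^ 2 := by positivity
    linarith

lemma X_sup (hu : MemX R u) {r : ℝ} (hr : r ∈ Icc 0 R) :
    (u r) ^ 2 ≤ ∫ r in Ioo 0 R, (r * (deriv u r) ^ 2 + (u r) ^ 2 / r) := by
  have hI := hu.2.2.2.2
  have hsub : Ioo 0 r ⊆ Ioo 0 R := Ioo_subset_Ioo_right hr.2
  have key := intervalIntegral.sub_le_integral_of_hasDeriv_right_of_le (g := fun s => (u s) ^ 2)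
    (g' := fun s => 2 * u s * deriv u s)
    (φ := fun r => r * (deriv u r) ^ 2 + (u r) ^ 2 / r) hr.1
    ((hu.1.mono (Icc_subset_Icc_right hr.2)).pow 2) ?_
    ((integrableOn_Icc_iff_integrableOn_Ioo).2 (hI.mono_set hsub)) ?_
  · rw [intervalIntegral.integral_of_le hr.1, integral_Ioc_eq_integral_Ioo, hu.2.2.1] at key
    have h2 : ∫ r in Ioo 0 r, (r * (deriv u r) ^ 2 + (u r) ^ 2 / r) ≤
        ∫ r in Ioo 0 R, (r * (deriv u r) ^ 2 + (u r) ^ 2 / r) := by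
      refine setIntegral_mono_set hI ?_ hsub.eventuallyLE
      refine (ae_restrict_iff' measurableSet_Ioo).2 (Eventually.of_forall fun s hs => ?_)
      have h0 : 0 < s := hs.1
      simp only [Pi.zero_apply]
      positivity
    linarith
  · intro s hs
    have := (X_diff hu (hsub hs)).pow 2
    refine HasDerivAt.hasDerivWithinAt ?_
    refine this.congr_deriv ?_
    simp
  · intro s hs
    have h0 : 0 < s := hs.1
    have : s * (deriv u s) ^ 2 + (u s) ^ 2 / s - 2 * u s * deriv u s
        = s * (deriv u s - u s / s) ^ 2 := by
      field_simp
      ring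
    have h4 : 0 ≤ s * (deriv u s - u s / s) ^ 2 := by positivity
    linarith

end

lemma exists_l (R q : ℝ) (hR : 0 < R) (hq : 0 < besselR0 ^ 2 + q) :
    ∃ l : ℝ, 0 ≤ l ∧ (l * R < besselR0 ∨ l * R = 0) ∧ 0 < (l * R) ^ 2 + q := by
  have h0 : 0 ≤ besselR0 := Real.sInf_nonneg fun w hw => hw.1.le
  rcases h0.eq_or_lt with h | h
  · refine ⟨0, le_rfl, Or.inr (by simp), ?_⟩
    rw [← h] at hq
    simpa using hq
  · have hc : Tendsto (fun x : ℝ => x ^ 2 + q) (nhdsWithin besselR0 (Iio besselR0))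
        (nhds (besselR0 ^ 2 + q)) :=
      ((by fun_prop : Continuous fun x : ℝ => x ^ 2 + q).tendsto besselR0).mono_left
        nhdsWithin_le_nhds
    obtain ⟨x, hx1, hx2⟩ := ((hc.eventually (lt_mem_nhds hq)).and
      (Ioo_mem_nhdsLT h)).exists
    refine ⟨x / R, div_nonneg hx2.1.le hR.le, Or.inl ?_, ?_⟩
    · rw [div_mul_cancel₀ _ hR.ne']; exact hx2.2
    · rw [div_mul_cancel₀ _ hR.ne']; exact hx1

/-- uniform lower bounds on the Nehari set. -/
theorem stmt14 (α : ℝ) (hα : 0 < α) (n : ℤ) (hn : 1 ≤ |n|) (R : ℝ) (hR : 0 < R)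
    (κ : ℝ) (hκ1 : -(besselR0 ^ 2 + (n : ℝ) ^ 2) / (2 * R ^ 2) < κ) (hκ2 : κ < α⁻¹) :
    ∃ C₃ > (0 : ℝ), ∃ C₂ > (0 : ℝ), ∀ u : ℝ → ℝ, MemX R u →
      (∃ r ∈ Icc (0 : ℝ) R, u r ≠ 0) → gammaK α n κ R u = 0 →
      C₃ ≤ (∫ r in Ioo (0 : ℝ) R, r * (u r) ^ 2 / (1 + α * (u r) ^ 2)) ∧
      C₂ ≤ ∫ r in Ioo (0 : ℝ) R, r * (u r) ^ 4 / (1 + α * (u r) ^ 2) ^ 2 := by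
  have hn2 : (1 : ℝ) ≤ (n : ℝ) ^ 2 := by
    have : (1 : ℝ) ≤ |(n : ℝ)| := by exact_mod_cast hn
    rw [← sq_abs]; nlinarith
  obtain ⟨l, hl0, hlx, hl⟩ := exists_l R ((n : ℝ) ^ 2 + 2 * κ * R ^ 2) hR (by
    rw [div_lt_iff₀ (by positivity)] at hκ1
    linarith)
  set δ : ℝ := l ^ 2 + (n : ℝ) ^ 2 / R ^ 2 + 2 * κ with hδ
  have hδ0 : 0 < δ := by
    have : δ = ((l * R) ^ 2 + ((n : ℝ) ^ 2 + 2 * κ * R ^ 2)) / R ^ 2 := by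
      rw [hδ]; field_simp; ring
    rw [this]; positivity
  have hm0 : 0 < l ^ 2 + 1 / R ^ 2 := by positivity
  set c : ℝ := min 1 (δ / (l ^ 2 + 1 / R ^ 2)) with hc
  have hc0 : 0 < c := lt_min one_pos (by positivity)
  have hc1 : c ≤ 1 := min_le_left _ _
  have hc2 : c * (l ^ 2 + 1 / R ^ 2) ≤ δ := (le_div_iff₀ hm0).1 (min_le_right _ _)
  refine ⟨c / 2, by positivity, 2 * (c / 2) ^ 2 / R ^ 2, by positivity, ?_⟩
  intro u hu ⟨r₁, hr₁, hur₁⟩ hγ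
  have hden : ∀ x : ℝ, 1 + α * x ^ 2 ≠ 0 := fun x => by positivity
  have hA := X_intA hu
  have hB := X_intB hu
  have hP := X_intC hu (fun x => x ^ 2) (by fun_prop)
  have hS := X_intC hu (fun x => x ^ 2 / (1 + α * x ^ 2)) (by fun_prop (disch := exact hden _))
  have hQ := X_intC hu (fun x => x ^ 4 / (1 + α * x ^ 2)) (by fun_prop (disch := exact hden _))
  have hT := X_intC hu (fun x => x ^ 4 / (1 + α * x ^ 2) ^ 2)
    (by fun_prop (disch := exact fun x => pow_ne_zero 2 (hden x)))
  have hL := X_poinc hR hu hl0 hlx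
  have hsup := fun r (hr : r ∈ Icc 0 R) => X_sup hu hr
  rw [integral_add hA hB] at hsup
  set A := ∫ r in Ioo 0 R, r * (deriv u r) ^ 2
  set B := ∫ r in Ioo 0 R, (u r) ^ 2 / r
  set P := ∫ r in Ioo 0 R, r * (u r) ^ 2
  simp only [mul_div_assoc]
  set S := ∫ r in Ioo 0 R, r * ((u r) ^ 2 / (1 + α * (u r) ^ 2))
  set Q := ∫ r in Ioo 0 R, r * ((u r) ^ 4 / (1 + α * (u r) ^ 2)) with hQd
  set T := ∫ r in Ioo 0 R, r * ((u r) ^ 4 / (1 + α * (u r) ^ 2) ^ 2)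
  have hPB : P / R ^ 2 ≤ B := by
    rw [← integral_div]
    refine setIntegral_mono_on (hP.div_const _) hB measurableSet_Ioo (fun r hr => ?_)
    have h0 : 0 < r := hr.1
    have h1 : r ^ 2 ≤ R ^ 2 := pow_le_pow_left₀ h0.le hr.2.le 2
    rw [div_le_div_iff₀ (by positivity) h0]
    have := mul_le_mul_of_nonneg_left h1 (sq_nonneg (u r))
    nlinarith
  have hP0 : 0 ≤ P := by
    refine setIntegral_nonneg measurableSet_Ioo (fun r hr => ?_)
    have h0 : 0 < r := hr.1
    positivity
  have hE : 0 < A + B := lt_of_lt_of_le (by positivity) (hsup r₁ hr₁)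
  have hbal : A + (n : ℝ) ^ 2 * B + 2 * κ * P = 2 * Q := by
    have e : ∫ r in Ioo (0 : ℝ) R,
      (r * (deriv u r) ^ 2 + ((n : ℝ) ^ 2 / r) * (u r) ^ 2
      - 2 * (α⁻¹ - κ) * r * (u r) ^ 2 + 2 * α⁻¹ * r * (u r) ^ 2 / (1 + α * (u r) ^ 2))
      = ∫ r in Ioo (0 : ℝ) R, (r * (deriv u r) ^ 2 + (n : ℝ) ^ 2 * ((u r) ^ 2 / r)
        + 2 * κ * (r * (u r) ^ 2) - 2 * (r * ((u r) ^ 4 / (1 + α * (u r) ^ 2)))) := by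
      refine setIntegral_congr_fun measurableSet_Ioo (fun r hr => ?_)
      have h0 : r ≠ 0 := hr.1.ne'
      have := hden (u r)
      field_simp
      ring
    unfold gammaK at hγ
    rw [e, integral_sub, integral_add, integral_add, integral_const_mul, integral_const_mul,
      integral_const_mul] at hγ
    · simp only [A, B, P, Q]; linarith
    · exact hA
    · exact hB.const_mul _
    · exact hA.add (hB.const_mul _)
    · exact hP.const_mul _
    · exact (hA.add (hB.const_mul _)).add (hP.const_mul _)
    · exact hQ.const_mul _
  have hcoer : c * (A + B) ≤ 2 * Q := by
    have h1 : (1 - c) * (l ^ 2 * P) ≤ (1 - c) * A := mul_le_mul_of_nonneg_left hL (by linarith)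
    have h2 : ((n : ℝ) ^ 2 - c) * (P / R ^ 2) ≤ ((n : ℝ) ^ 2 - c) * B :=
      mul_le_mul_of_nonneg_left hPB (by linarith)
    have h3 := mul_le_mul_of_nonneg_right hc2 hP0
    have h4 : (1 - c) * (l ^ 2 * P) + ((n : ℝ) ^ 2 - c) * (P / R ^ 2) + 2 * κ * P
        = δ * P - c * (l ^ 2 + 1 / R ^ 2) * P := by rw [hδ]; ring
    linarith
  have hQS : Q ≤ (A + B) * S := by
    rw [← integral_const_mul]
    refine setIntegral_mono_on hQ (hS.const_mul _) measurableSet_Ioo (fun r hr => ?_)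
    have h0 : 0 < r := hr.1
    have h1 := hsup r (Ioo_subset_Icc_self hr)
    have h2 : 0 ≤ r * ((u r) ^ 2 / (1 + α * (u r) ^ 2)) := by positivity
    calc r * ((u r) ^ 4 / (1 + α * (u r) ^ 2))
        = (u r) ^ 2 * (r * ((u r) ^ 2 / (1 + α * (u r) ^ 2))) := by ring
      _ ≤ _ := mul_le_mul_of_nonneg_right h1 h2
  have hS3 : c / 2 ≤ S := by
    have : (A + B) * (c / 2) ≤ (A + B) * S := by linarith
    exact le_of_mul_le_mul_left this hE
  refine ⟨hS3, ?_⟩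
  set d := c / 2 with hd
  have hd0 : 0 < d := by positivity
  have hid : ∫ r in Ioo 0 R, r = R ^ 2 / 2 := by
    rw [← integral_Ioc_eq_integral_Ioo, ← intervalIntegral.integral_of_le hR.le, integral_id]
    ring
  have hidI : IntegrableOn (fun r : ℝ => r) (Ioo 0 R) :=
    (continuous_id.continuousOn.integrableOn_Icc (a := 0) (b := R)).mono_set Ioo_subset_Icc_self
  have hST : S ≤ (d / R ^ 2) * (R ^ 2 / 2) + R ^ 2 / (4 * d) * T := by
    rw [← hid, ← integral_const_mul, ← integral_const_mul,
      ← integral_add (hidI.const_mul _) (hT.const_mul _)]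
    refine setIntegral_mono_on hS ((hidI.const_mul _).add (hT.const_mul _)) measurableSet_Ioo
      (fun r hr => ?_)
    have h0 : 0 < r := hr.1
    set w := (u r) ^ 2 / (1 + α * (u r) ^ 2) with hw
    have hw2 : (u r) ^ 4 / (1 + α * (u r) ^ 2) ^ 2 = w ^ 2 := by rw [hw, div_pow]; ring
    simp only [hw2]
    have : d / R ^ 2 * r + R ^ 2 / (4 * d) * (r * w ^ 2) - r * w
        = r * (R ^ 2 / (4 * d)) * (w - 2 * d / R ^ 2) ^ 2 := by
      field_simp
      ring
    have h5 : 0 ≤ r * (R ^ 2 / (4 * d)) * (w - 2 * d / R ^ 2) ^ 2 := by positivity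
    linarith
  have h6 : d / 2 ≤ R ^ 2 / (4 * d) * T := by
    have : (d / R ^ 2) * (R ^ 2 / 2) = d / 2 := by field_simp
    linarith
  have h7 : R ^ 2 / (4 * d) * T = T * R ^ 2 / (4 * d) := by ring
  rw [h7, le_div_iff₀ (by positivity)] at h6
  have h8 : 2 * d ^ 2 / R ^ 2 ≤ T := by
    rw [div_le_iff₀ (by positivity)]; linarith
  simpa [mul_div_assoc] using h8
end

section
/- Let α > 0, let n be an integer with |n| ≥ 1, let R > 0, let κ < α⁻¹, and let β > 0. If (u_j) is a sequence of functions in the Nehari set M with |I_κ(u_j)| ≤ β for every j, then sup over j of ∫₀^R ( r u_j'(r)² + u_j(r)²/r ) dr is finite. -/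
open MeasureTheory Set Filter

lemma aux_lin (μ : Measure ℝ) (f g h k : ℝ → ℝ) (hf : Integrable f μ) (hg : Integrable g μ)
    (hh : Integrable h μ) (hk : Integrable k μ) (a b d : ℝ) :
    ∫ x, (f x + a * g x - b * h x + d * k x) ∂μ =
      (∫ x, f x ∂μ) + a * (∫ x, g x ∂μ) - b * (∫ x, h x ∂μ) + d * ∫ x, k x ∂μ := by
  have h1 : Integrable (fun x => f x + a * g x) μ := hf.add (hg.const_mul a)
  have h2 : Integrable (fun x => f x + a * g x - b * h x) μ := h1.sub (hh.const_mul b)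
  rw [integral_add h2 (hk.const_mul d), integral_sub h1 (hh.const_mul b),
    integral_add hf (hg.const_mul a), integral_const_mul, integral_const_mul, integral_const_mul]

lemma aux_sup (R : ℝ) (u : ℝ → ℝ) (h : MemX R u) (r : ℝ) (hr : r ∈ Ioo (0 : ℝ) R) :
    (u r) ^ 2 ≤ ∫ r in Ioo (0 : ℝ) R, (r * (deriv u r) ^ 2 + (u r) ^ 2 / r) := by
  obtain ⟨hc, hd, h0, hR, hint⟩ := h
  have hsub : Ioc (0 : ℝ) r ⊆ Ioo 0 R := fun x hx => ⟨hx.1, lt_of_le_of_lt hx.2 hr.2⟩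
  have key := intervalIntegral.sub_le_integral_of_hasDeriv_right_of_le (a := 0) (b := r)
    (g := fun x => (u x) ^ 2) (g' := fun x => 2 * u x * deriv u x)
    (φ := fun r => r * (deriv u r) ^ 2 + (u r) ^ 2 / r) hr.1.le
    ((hc.mono (Icc_subset_Icc_right hr.2.le)).pow 2) ?_ ?_ ?_
  · simp only [h0] at key
    rw [intervalIntegral.integral_of_le hr.1.le] at key
    have h2 : (∫ r in Ioc (0 : ℝ) r, (r * (deriv u r) ^ 2 + (u r) ^ 2 / r)) ≤
        ∫ r in Ioo (0 : ℝ) R, (r * (deriv u r) ^ 2 + (u r) ^ 2 / r) := by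
      apply setIntegral_mono_set hint _ hsub.eventuallyLE
      filter_upwards [ae_restrict_mem measurableSet_Ioo] with x hx
      have := hx.1
      simp only [Pi.zero_apply]
      positivity
    linarith
  · intro x hx
    have hx' : x ∈ Ioo 0 R := ⟨hx.1, hx.2.trans hr.2⟩
    have hdx : DifferentiableAt ℝ u x :=
      (hd.differentiableOn (by norm_num)).differentiableAt (isOpen_Ioo.mem_nhds hx')
    have := (hdx.hasDerivAt.pow 2).hasDerivWithinAt (s := Ioi x)
    have e2 : ((2 : ℕ) : ℝ) * u x ^ (2 - 1) * deriv u x = 2 * u x * deriv u x := by norm_num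
    rw [e2] at this
    exact this
  · rw [integrableOn_Icc_iff_integrableOn_Ioc]
    exact hint.mono_set hsub
  · intro x hx
    have hx0 := hx.1
    have e : x * (deriv u x) ^ 2 + (u x) ^ 2 / x - 2 * u x * deriv u x
        = (x * deriv u x - u x) ^ 2 / x := by
      field_simp
      ring
    have : 0 ≤ (x * deriv u x - u x) ^ 2 / x := by positivity
    linarith

lemma aux_main (α : ℝ) (hα : 0 < α) (n : ℤ) (hn : 1 ≤ |n|) (R : ℝ) (hR : 0 < R)
    (κ : ℝ) (hκ : κ < α⁻¹) (β : ℝ) (hβ : 0 < β) (T : ℝ) (hT : 0 < T)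
    (hTK : 1 + 4 * (α⁻¹ - κ) * (α ^ 2 * β) ≤ Real.log (1 + α * T))
    (u : ℝ → ℝ) (hX : MemX R u) (hg : gammaK α n κ R u = 0) (hb : |actI α n κ R u| ≤ β) :
    (∫ r in Ioo (0 : ℝ) R, (r * (deriv u r) ^ 2 + (u r) ^ 2 / r)) ≤
      4 * (α⁻¹ - κ) * (T * R * R) := by
  have hsup := aux_sup R u hX
  obtain ⟨hc, hd, h0, hR0, hint⟩ := hX
  set c := α⁻¹ - κ with hcdef
  have hcpos : 0 < c := by linarith
  set μ := (volume : Measure ℝ).restrict (Ioo 0 R) with hμ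
  have hum : AEStronglyMeasurable u μ :=
    (hc.mono Ioo_subset_Icc_self).aestronglyMeasurable measurableSet_Ioo
  have hum' : AEMeasurable u μ := hum.aemeasurable
  have hdm : Measurable (deriv u) := measurable_deriv u
  have hmem : ∀ᵐ x ∂μ, x ∈ Ioo (0 : ℝ) R := ae_restrict_mem measurableSet_Ioo
  have iA : Integrable (fun r => r * (deriv u r) ^ 2) μ := by
    refine Integrable.mono' hint ?_ ?_
    · exact (measurable_id.mul (hdm.pow_const 2)).aestronglyMeasurable
    · filter_upwards [hmem] with x hx
      have := hx.1
      rw [Real.norm_of_nonneg (by positivity)]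
      have : 0 ≤ (u x) ^ 2 / x := by positivity
      linarith
  have iB : Integrable (fun r => (u r) ^ 2 / r) μ := by
    refine Integrable.mono' hint ?_ ?_
    · exact ((hum'.pow_const 2).div measurable_id.aemeasurable).aestronglyMeasurable
    · filter_upwards [hmem] with x hx
      have := hx.1
      rw [Real.norm_of_nonneg (by positivity)]
      have : 0 ≤ x * (deriv u x) ^ 2 := by positivity
      linarith
  have iD : Integrable (fun r => r * (u r) ^ 2) μ := by
    refine Integrable.mono' (iB.const_mul (R ^ 2)) ?_ ?_
    · exact (measurable_id.aemeasurable.mul (hum'.pow_const 2)).aestronglyMeasurable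
    · filter_upwards [hmem] with x hx
      have hx0 := hx.1
      rw [Real.norm_of_nonneg (by positivity)]
      have e : x * u x ^ 2 = x ^ 2 * (u x ^ 2 / x) := by field_simp
      rw [e]
      have := hx.2.le
      gcongr
  have iL : Integrable (fun r => r * Real.log (1 + α * (u r) ^ 2)) μ := by
    refine Integrable.mono' (iD.const_mul α) ?_ ?_
    · exact (measurable_id.aemeasurable.mul
        (Real.measurable_log.comp_aemeasurable
          (((hum'.pow_const 2).const_mul α).const_add 1))).aestronglyMeasurable
    · filter_upwards [hmem] with x hx
      have hx0 := hx.1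
      have hs : 0 ≤ α * u x ^ 2 := by positivity
      have hl : 0 ≤ Real.log (1 + α * u x ^ 2) := Real.log_nonneg (by linarith)
      rw [Real.norm_of_nonneg (by positivity)]
      have h1 := Real.log_le_sub_one_of_pos (x := 1 + α * u x ^ 2) (by linarith)
      have := mul_le_mul_of_nonneg_left h1 hx0.le
      linarith
  have iP : Integrable (fun r => r * (u r) ^ 2 / (1 + α * (u r) ^ 2)) μ := by
    refine Integrable.mono' iD ?_ ?_
    · exact ((measurable_id.aemeasurable.mul (hum'.pow_const 2)).div
          (((hum'.pow_const 2).const_mul α).const_add 1)).aestronglyMeasurable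
    · filter_upwards [hmem] with x hx
      have hx0 := hx.1
      have hs : 0 ≤ α * u x ^ 2 := by positivity
      rw [Real.norm_of_nonneg (by positivity)]
      exact div_le_self (by positivity) (by linarith)
  set A := ∫ r, r * (deriv u r) ^ 2 ∂μ with hA
  set B := ∫ r, (u r) ^ 2 / r ∂μ with hB
  set D := ∫ r, r * (u r) ^ 2 ∂μ with hD
  set L := ∫ r, r * Real.log (1 + α * (u r) ^ 2) ∂μ with hL
  set P := ∫ r, r * (u r) ^ 2 / (1 + α * (u r) ^ 2) ∂μ with hP
  have eE : (∫ r, (r * (deriv u r) ^ 2 + (u r) ^ 2 / r) ∂μ) = A + B := integral_add iA iB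
  have eI : actI α n κ R u = (1 / 2) * (A + n ^ 2 * B - 2 * c * D + 2 * (α ^ 2)⁻¹ * L) := by
    unfold actI
    rw [hA, hB, hD, hL, ← aux_lin μ _ _ _ _ iA iB iD iL]
    congr 1
    apply integral_congr_ae
    filter_upwards with x
    rw [hcdef]
    ring
  have eG : gammaK α n κ R u = (1 / 2) * (A + n ^ 2 * B - 2 * c * D + 2 * α⁻¹ * P) := by
    unfold gammaK
    rw [hA, hB, hD, hP, ← aux_lin μ _ _ _ _ iA iB iD iP]
    congr 1
    apply integral_congr_ae
    filter_upwards with x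
    rw [hcdef]
    ring
  rw [eE] at hsup ⊢
  set E := A + B with hE
  have hA0 : 0 ≤ A := integral_nonneg_of_ae (by
    filter_upwards [hmem] with x hx
    have := hx.1
    simp only [Pi.zero_apply]
    positivity)
  have hB0 : 0 ≤ B := integral_nonneg_of_ae (by
    filter_upwards [hmem] with x hx
    have := hx.1
    simp only [Pi.zero_apply]
    positivity)
  have hP0 : 0 ≤ P := integral_nonneg_of_ae (by
    filter_upwards [hmem] with x hx
    have := hx.1
    simp only [Pi.zero_apply]
    positivity)
  have hE0 : 0 ≤ E := by linarith
  have hn2 : (1 : ℝ) ≤ (n : ℝ) ^ 2 := by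
    have : (1 : ℝ) ≤ |(n : ℝ)| := by exact_mod_cast hn
    rw [← sq_abs]
    nlinarith
  rw [eG] at hg
  rw [eI] at hb
  have hG : L - α * P ≤ α ^ 2 * β := by
    have h1 := (abs_le.1 hb).2
    have h2 : (α ^ 2)⁻¹ * L - α⁻¹ * P ≤ β := by linarith
    have h3 : L - α * P = α ^ 2 * ((α ^ 2)⁻¹ * L - α⁻¹ * P) := by field_simp
    rw [h3]
    gcongr
  have hED : E ≤ 2 * c * D := by
    have h1 : 0 ≤ α⁻¹ * P := by positivity
    have h2 : B ≤ n ^ 2 * B := le_mul_of_one_le_left hB0 hn2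
    linarith
  set K := 4 * c * (α ^ 2 * β) with hK
  have hKpos : 0 < K := by positivity
  have hDle : D ≤ T * R * R + E / K * (L - α * P) := by
    have e : T * R * R + E / K * (L - α * P) = ∫ r, (T * R + E / K *
        (r * Real.log (1 + α * (u r) ^ 2) - α * (r * (u r) ^ 2 / (1 + α * (u r) ^ 2)))) ∂μ := by
      have i1 : Integrable (fun r => r * Real.log (1 + α * (u r) ^ 2) -
          α * (r * (u r) ^ 2 / (1 + α * (u r) ^ 2))) μ := iL.sub (iP.const_mul _)
      rw [integral_add (integrable_const _) (i1.const_mul _),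
        integral_const_mul (E / K), integral_sub iL (iP.const_mul _), integral_const_mul α,
        integral_const]
      simp [hμ, hR.le]
      ring
    rw [e]
    apply integral_mono_ae iD
      ((integrable_const _).add ((iL.sub (iP.const_mul _)).const_mul _))
    filter_upwards [hmem] with x hx
    have hx0 := hx.1
    have hs : 0 ≤ α * u x ^ 2 := by positivity
    have hpos : 0 < 1 + α * u x ^ 2 := by linarith
    have e1 : x * Real.log (1 + α * u x ^ 2) - α * (x * u x ^ 2 / (1 + α * u x ^ 2))
        = x * (Real.log (1 + α * u x ^ 2) - (1 - (1 + α * u x ^ 2)⁻¹)) := by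
      field_simp
      ring
    simp only [Pi.add_apply, Pi.sub_apply]
    rw [e1]
    have hg0 := Real.one_sub_inv_le_log_of_pos hpos
    have hEK : 0 ≤ E / K := by positivity
    rcases le_total (u x ^ 2) T with h | h
    · have h1 : x * u x ^ 2 ≤ R * T := mul_le_mul hx.2.le h (by positivity) hR.le
      have h2 : 0 ≤ E / K * (x * (Real.log (1 + α * u x ^ 2) - (1 - (1 + α * u x ^ 2)⁻¹))) :=
        mul_nonneg hEK (mul_nonneg hx0.le (by linarith))
      linarith
    · have h1 : Real.log (1 + α * T) ≤ Real.log (1 + α * u x ^ 2) :=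
        Real.log_le_log (by positivity) (by gcongr)
      have h3 : 0 < (1 + α * u x ^ 2)⁻¹ := by positivity
      have h2 : K ≤ Real.log (1 + α * u x ^ 2) - (1 - (1 + α * u x ^ 2)⁻¹) := by linarith
      have h4 : E / K * (x * K) ≤
          E / K * (x * (Real.log (1 + α * u x ^ 2) - (1 - (1 + α * u x ^ 2)⁻¹))) := by gcongr
      have h5 : E / K * (x * K) = x * E := by field_simp
      have h6 : x * u x ^ 2 ≤ x * E := mul_le_mul_of_nonneg_left (hsup x hx) hx0.le
      have h7 : 0 < T * R := by positivity
      linarith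
  have h8 : E / K * (L - α * P) ≤ E / K * (α ^ 2 * β) := by gcongr
  have h9 : 2 * c * (E / K * (α ^ 2 * β)) = E / 2 := by
    rw [hK]
    field_simp
    ring
  have h10 : 2 * c * D ≤ 2 * c * (T * R * R + E / K * (α ^ 2 * β)) := by
    gcongr
    linarith
  linarith

/-- sequences on the Nehari set with bounded action are bounded in `H`. -/
theorem stmt15 (α : ℝ) (hα : 0 < α) (n : ℤ) (hn : 1 ≤ |n|) (R : ℝ) (hR : 0 < R)
    (κ : ℝ) (hκ : κ < α⁻¹) (β : ℝ) (hβ : 0 < β)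
    (u : ℕ → ℝ → ℝ)
    (hM : ∀ j, MemX R (u j) ∧ (∃ r ∈ Icc (0 : ℝ) R, u j r ≠ 0) ∧
      gammaK α n κ R (u j) = 0)
    (hbd : ∀ j, |actI α n κ R (u j)| ≤ β) :
    ∃ C : ℝ, ∀ j,
      (∫ r in Ioo (0 : ℝ) R, (r * (deriv (u j) r) ^ 2 + (u j r) ^ 2 / r)) ≤ C := by
  set K := 1 + 4 * (α⁻¹ - κ) * (α ^ 2 * β) with hK
  refine ⟨4 * (α⁻¹ - κ) * (Real.exp K / α * R * R), fun j => ?_⟩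
  obtain ⟨hX, -, hg⟩ := hM j
  refine aux_main α hα n hn R hR κ hκ β hβ (Real.exp K / α) (by positivity) ?_ (u j) hX hg (hbd j)
  have e : 1 + α * (Real.exp K / α) = 1 + Real.exp K := by field_simp
  rw [e, ← hK, Real.le_log_iff_exp_le (by positivity)]
  linarith
end
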